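/- arXiv:2403.12569 — 2 statements merged into one kernel-verified Lean document; each statement's English description precedes it below -/
import Mathlib

section
/- Let Q be the quadratic form Q(x) = λ₁x₁² + λ₂x₂² + λ₃x₃² on ℝ³ with λᵢ ∈ {1, -1}, and let Cl(Q) be its real Clifford algebra. For x ∈ Cl(Q) let x̃ denote the Clifford conjugation of x, i.e., the reversal of the grade involution of x. Then for every x ∈ Cl(Q), the element x·x̃ lies in the center of Cl(Q). -/
open CliffordAlgebra

/-- Clifford conjugation: the composition of reversion with the grade involution. -/
noncomputable def cliffordConj {Q : QuadraticForm ℝ (Fin 3 → ℝ)}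
    (x : CliffordAlgebra Q) : CliffordAlgebra Q :=
  reverse (involute x)

namespace CliffordAlgebra

section General

variable {R M : Type*} [CommRing R] [AddCommGroup M] [Module R M] {Q : QuadraticForm R M}

theorem mem_center_of_forall_commute_ι {z : CliffordAlgebra Q}
    (hz : ∀ m, Commute z (ι Q m)) : z ∈ Subalgebra.center R (CliffordAlgebra Q) := by
  rw [Subalgebra.mem_center_iff]
  intro b
  change Commute b z
  symm
  induction b using CliffordAlgebra.induction with
  | algebraMap r => exact (Algebra.commutes r z).symm
  | ι m => exact hz m
  | mul a b ha hb => exact ha.mul_right hb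
  | add a b ha hb => exact ha.add_right hb

end General

section Three

variable {l : Fin 3 → ℝ}

/-- The image in the Clifford algebra of the `i`-th standard basis vector of `ℝ³`. -/
noncomputable def stdGen (l : Fin 3 → ℝ) (i : Fin 3) :
    CliffordAlgebra (QuadraticMap.weightedSumSquares ℝ l) :=
  ι _ (Pi.single i 1)

theorem stdGen_mul_self (i : Fin 3) : stdGen l i * stdGen l i = l i • 1 := by
  rw [stdGen, ι_sq_scalar, Algebra.algebraMap_eq_smul_one]
  congr 1
  fin_cases i <;> simp [QuadraticMap.weightedSumSquares_apply, Fin.sum_univ_three]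

theorem stdGen_mul_stdGen_of_ne {i j : Fin 3} (h : i ≠ j) :
    stdGen l i * stdGen l j = -(stdGen l j * stdGen l i) := by
  refine ι_mul_ι_comm_of_isOrtho ?_
  rw [QuadraticMap.isOrtho_def]
  fin_cases i <;> fin_cases j <;>
    simp_all [QuadraticMap.weightedSumSquares_apply, Fin.sum_univ_three, add_comm]

theorem ι_eq_sum_stdGen (m : Fin 3 → ℝ) :
    ι (QuadraticMap.weightedSumSquares ℝ l) m =
      m 0 • stdGen l 0 + m 1 • stdGen l 1 + m 2 • stdGen l 2 := by
  simp only [stdGen, ← map_smul, ← map_add]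
  congr 1
  ext i
  fin_cases i <;> simp

theorem stdGen_mul_self_mul (i : Fin 3) (x) : stdGen l i * (stdGen l i * x) = l i • x := by
  rw [← mul_assoc, stdGen_mul_self, smul_mul_assoc, one_mul]

theorem stdGen_mul_stdGen_mul_of_ne {i j : Fin 3} (h : i ≠ j) (x) :
    stdGen l i * (stdGen l j * x) = -(stdGen l j * (stdGen l i * x)) := by
  rw [← mul_assoc, stdGen_mul_stdGen_of_ne h, neg_mul, mul_assoc]

/-- Rewriting rules sorting a product of standard generators by increasing index. -/
theorem stdGen_sort :
    (stdGen l 1 * stdGen l 0 = -(stdGen l 0 * stdGen l 1) ∧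
      stdGen l 2 * stdGen l 0 = -(stdGen l 0 * stdGen l 2) ∧
      stdGen l 2 * stdGen l 1 = -(stdGen l 1 * stdGen l 2)) ∧
    (∀ x, stdGen l 1 * (stdGen l 0 * x) = -(stdGen l 0 * (stdGen l 1 * x))) ∧
    (∀ x, stdGen l 2 * (stdGen l 0 * x) = -(stdGen l 0 * (stdGen l 2 * x))) ∧
    (∀ x, stdGen l 2 * (stdGen l 1 * x) = -(stdGen l 1 * (stdGen l 2 * x))) := by
  refine ⟨⟨?_, ?_, ?_⟩, fun x ↦ ?_, fun x ↦ ?_, fun x ↦ ?_⟩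
  all_goals first
    | exact stdGen_mul_stdGen_of_ne (by decide)
    | exact stdGen_mul_stdGen_mul_of_ne (by decide) x

theorem exists_eq_stdGen_combination
    (x : CliffordAlgebra (QuadraticMap.weightedSumSquares ℝ l)) :
    ∃ a b₀ b₁ b₂ c₀ c₁ c₂ d : ℝ,
      x = a • 1 + b₀ • stdGen l 0 + b₁ • stdGen l 1 + b₂ • stdGen l 2
        + c₀ • (stdGen l 1 * stdGen l 2) + c₁ • (stdGen l 0 * stdGen l 2)
        + c₂ • (stdGen l 0 * stdGen l 1) + d • (stdGen l 0 * (stdGen l 1 * stdGen l 2)) := by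
  induction x using CliffordAlgebra.left_induction with
  | algebraMap r =>
    exact ⟨r, 0, 0, 0, 0, 0, 0, 0, by simp [Algebra.algebraMap_eq_smul_one]⟩
  | add x y hx hy =>
    obtain ⟨a, b₀, b₁, b₂, c₀, c₁, c₂, d, rfl⟩ := hx
    obtain ⟨a', b₀', b₁', b₂', c₀', c₁', c₂', d', rfl⟩ := hy
    exact ⟨a + a', b₀ + b₀', b₁ + b₁', b₂ + b₂', c₀ + c₀', c₁ + c₁', c₂ + c₂', d + d',
      by module⟩
  | ι_mul x m hx =>
    obtain ⟨a, b₀, b₁, b₂, c₀, c₁, c₂, d, rfl⟩ := hx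
    refine ⟨m 0 * b₀ * l 0 + m 1 * b₁ * l 1 + m 2 * b₂ * l 2,
      m 0 * a - m 1 * c₂ * l 1 - m 2 * c₁ * l 2,
      m 1 * a + m 0 * c₂ * l 0 - m 2 * c₀ * l 2,
      m 2 * a + m 0 * c₁ * l 0 + m 1 * c₀ * l 1,
      m 1 * b₂ - m 2 * b₁ + m 0 * d * l 0,
      m 0 * b₂ - m 2 * b₀ - m 1 * d * l 1,
      m 0 * b₁ - m 1 * b₀ + m 2 * d * l 2,
      m 0 * c₀ - m 1 * c₁ + m 2 * c₂, ?_⟩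
    simp only [ι_eq_sum_stdGen, mul_add, add_mul, smul_mul_assoc, mul_smul_comm, mul_one,
      stdGen_mul_self, stdGen_mul_self_mul, stdGen_sort, mul_neg]
    module

theorem stdGen_pseudoscalar_mem_center :
    stdGen l 0 * (stdGen l 1 * stdGen l 2) ∈ Subalgebra.center ℝ
      (CliffordAlgebra (QuadraticMap.weightedSumSquares ℝ l)) := by
  refine mem_center_of_forall_commute_ι fun m ↦ ?_
  rw [Commute, SemiconjBy]
  simp only [ι_eq_sum_stdGen, mul_add, add_mul, smul_mul_assoc, mul_smul_comm, mul_one, mul_assoc,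
    stdGen_mul_self, stdGen_mul_self_mul, stdGen_sort, mul_neg]
  module

theorem add_reverse_involute_mem_center
    (x : CliffordAlgebra (QuadraticMap.weightedSumSquares ℝ l)) :
    x + reverse (involute x) ∈ Subalgebra.center ℝ
      (CliffordAlgebra (QuadraticMap.weightedSumSquares ℝ l)) := by
  obtain ⟨a, b₀, b₁, b₂, c₀, c₁, c₂, d, rfl⟩ := exists_eq_stdGen_combination x
  have hi (i) : involute (stdGen l i) = -stdGen l i := involute_ι _
  have hr (i) : reverse (stdGen l i) = stdGen l i := reverse_ι _
  convert add_mem (Subalgebra.smul_mem _ (one_mem _) (2 * a))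
    (Subalgebra.smul_mem _ (stdGen_pseudoscalar_mem_center (l := l)) (2 * d)) using 1
  simp only [map_add, map_smul, map_mul, map_one, map_neg, reverse.map_mul, reverse.map_one, hi,
    hr, mul_neg, neg_mul, neg_neg, mul_assoc, stdGen_sort]
  module

end Three

theorem reverse_involute_mul_reverse_involute {R M : Type*} [CommRing R] [AddCommGroup M]
    [Module R M] {Q : QuadraticForm R M} (x : CliffordAlgebra Q) :
    reverse (involute (x * reverse (involute x))) = x * reverse (involute x) := by
  rw [map_mul, reverse.map_mul, ← reverse_involute, reverse_reverse, involute_involute]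

end CliffordAlgebra

theorem mul_cliffordConj_mem_center
    (l : Fin 3 → ℝ) (hl : ∀ i, l i = 1 ∨ l i = -1)
    (Q : QuadraticForm ℝ (Fin 3 → ℝ)) (hQ : Q = QuadraticMap.weightedSumSquares ℝ l)
    (x : CliffordAlgebra Q) :
    x * cliffordConj x ∈ Subalgebra.center ℝ (CliffordAlgebra Q) := by
  subst hQ
  have h := add_reverse_involute_mem_center (x * reverse (involute x))
  rw [reverse_involute_mul_reverse_involute] at h
  convert Subalgebra.smul_mem _ h (2⁻¹ : ℝ) using 1
  rw [cliffordConj]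
  module
end

section
/- Let Q be the quadratic form Q(x) = λ₁x₁² + λ₂x₂² + λ₃x₃² on ℝ³ with λᵢ ∈ {1, -1}, and let Cl(Q) be its real Clifford algebra. For x ∈ Cl(Q) let x̃ denote the Clifford conjugation of x, and define the pseudoscalar-valued norm ñ(x) = x·x̃. Then ñ is multiplicative: for all x, y ∈ Cl(Q), (x·y)·(x·y)~ = (x·x̃)·(y·ỹ); in particular, (Cl(Q), ñ) satisfies the composition law ñ(xy) = ñ(x)ñ(y). -/
open CliffordAlgebra

section CliffordConj

variable {Q : QuadraticForm ℝ (Fin 3 → ℝ)}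

theorem cliffordConj_add (x y : CliffordAlgebra Q) :
    cliffordConj (x + y) = cliffordConj x + cliffordConj y := by
  simp [cliffordConj]

theorem cliffordConj_mul (x y : CliffordAlgebra Q) :
    cliffordConj (x * y) = cliffordConj y * cliffordConj x := by
  simp [cliffordConj]

theorem cliffordConj_ι (v : Fin 3 → ℝ) : cliffordConj (ι Q v) = -ι Q v := by
  simp [cliffordConj]

theorem cliffordConj_algebraMap (r : ℝ) :
    cliffordConj (algebraMap ℝ (CliffordAlgebra Q) r) = algebraMap ℝ _ r := by
  simp [cliffordConj]

variable (Q) in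
/-- The central elements fixed by Clifford conjugation. -/
noncomputable def centralSelfConj : Subalgebra ℝ (CliffordAlgebra Q) where
  carrier := {z | (∀ x, z * x = x * z) ∧ cliffordConj z = z}
  mul_mem' := by
    rintro a b ⟨ha, ha'⟩ ⟨hb, hb'⟩
    exact ⟨fun x ↦ by rw [mul_assoc, hb, ← mul_assoc, ha, mul_assoc],
      by rw [cliffordConj_mul, ha', hb', hb]⟩
  add_mem' := by
    rintro a b ⟨ha, ha'⟩ ⟨hb, hb'⟩
    exact ⟨fun x ↦ by rw [add_mul, mul_add, ha, hb], by rw [cliffordConj_add, ha', hb']⟩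
  algebraMap_mem' r := ⟨fun x ↦ Algebra.commutes r x, cliffordConj_algebraMap r⟩

/-- An element commuting with all vectors is central. -/
theorem commute_of_commute_ι {z : CliffordAlgebra Q}
    (h : ∀ v, z * ι Q v = ι Q v * z) (x : CliffordAlgebra Q) : z * x = x * z := by
  induction x using CliffordAlgebra.induction with
  | algebraMap r => exact (Algebra.commutes r z).symm
  | ι v => exact h v
  | mul a b ha hb => rw [← mul_assoc, ha, mul_assoc, hb, mul_assoc]
  | add a b ha hb => rw [mul_add, add_mul, ha, hb]

end CliffordConj

section WeightedSumSquares

variable {l : Fin 3 → ℝ}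

/-- The image of a standard basis vector in the Clifford algebra of a diagonal form. -/
noncomputable def diagGen (l : Fin 3 → ℝ) (i : Fin 3) :
    CliffordAlgebra (QuadraticMap.weightedSumSquares ℝ l) :=
  ι _ (Pi.single i 1)

theorem ι_eq_sum_diagGen (l v : Fin 3 → ℝ) :
    ι (QuadraticMap.weightedSumSquares ℝ l) v
      = v 0 • diagGen l 0 + v 1 • diagGen l 1 + v 2 • diagGen l 2 := by
  simp only [diagGen, ← map_smul, ← map_add]
  congr 1
  ext i
  fin_cases i <;> simp

theorem diagGen_mul_self (l : Fin 3 → ℝ) (i : Fin 3) :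
    diagGen l i * diagGen l i = l i • 1 := by
  rw [diagGen, ι_sq_scalar, Algebra.algebraMap_eq_smul_one]
  congr 1
  fin_cases i <;> simp [QuadraticMap.weightedSumSquares_apply, Fin.sum_univ_three]

theorem diagGen_mul_comm (l : Fin 3 → ℝ) {i j : Fin 3} (h : i ≠ j) :
    diagGen l i * diagGen l j = -(diagGen l j * diagGen l i) := by
  apply ι_mul_ι_comm_of_isOrtho
  rw [QuadraticMap.isOrtho_def]
  fin_cases i <;> fin_cases j <;>
    simp_all [QuadraticMap.weightedSumSquares_apply, Fin.sum_univ_three, add_comm]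

/-- The pseudoscalar, the product of the three standard generators. -/
noncomputable def diagPseudoscalar (l : Fin 3 → ℝ) :
    CliffordAlgebra (QuadraticMap.weightedSumSquares ℝ l) :=
  diagGen l 0 * diagGen l 1 * diagGen l 2

theorem diagPseudoscalar_mul_diagGen_zero (l : Fin 3 → ℝ) :
    diagPseudoscalar l * diagGen l 0 = l 0 • (diagGen l 1 * diagGen l 2) := by
  rw [diagPseudoscalar, mul_assoc, diagGen_mul_comm l (show (2 : Fin 3) ≠ 0 by decide), mul_neg,
    mul_assoc, ← mul_assoc (diagGen l 1), diagGen_mul_comm l (show (1 : Fin 3) ≠ 0 by decide),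
    neg_mul, mul_neg, neg_neg, mul_assoc, ← mul_assoc, diagGen_mul_self, smul_one_mul]

theorem diagPseudoscalar_mul_diagGen_one (l : Fin 3 → ℝ) :
    diagPseudoscalar l * diagGen l 1 = l 1 • (diagGen l 2 * diagGen l 0) := by
  rw [diagPseudoscalar, mul_assoc, diagGen_mul_comm l (show (2 : Fin 3) ≠ 1 by decide), mul_neg,
    mul_assoc, ← mul_assoc (diagGen l 1), diagGen_mul_self, smul_one_mul, mul_smul_comm,
    diagGen_mul_comm l (show (0 : Fin 3) ≠ 2 by decide), smul_neg, neg_neg]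

theorem diagPseudoscalar_mul_diagGen_two (l : Fin 3 → ℝ) :
    diagPseudoscalar l * diagGen l 2 = l 2 • (diagGen l 0 * diagGen l 1) := by
  rw [diagPseudoscalar, mul_assoc, diagGen_mul_self, mul_smul_one]

theorem diagPseudoscalar_mem_centralSelfConj (l : Fin 3 → ℝ) :
    diagPseudoscalar l ∈ centralSelfConj (QuadraticMap.weightedSumSquares ℝ l) := by
  have h10 := diagGen_mul_comm l (show (1 : Fin 3) ≠ 0 by decide)
  have h20 := diagGen_mul_comm l (show (2 : Fin 3) ≠ 0 by decide)
  have h21 := diagGen_mul_comm l (show (2 : Fin 3) ≠ 1 by decide)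
  refine ⟨commute_of_commute_ι fun v ↦ ?_, ?_⟩
  · have h0 : diagGen l 0 * diagPseudoscalar l = l 0 • (diagGen l 1 * diagGen l 2) := by
      rw [diagPseudoscalar, mul_assoc, ← mul_assoc, diagGen_mul_self, smul_one_mul]
    have h1 : diagGen l 1 * diagPseudoscalar l = l 1 • (diagGen l 2 * diagGen l 0) := by
      rw [diagPseudoscalar, ← mul_assoc, ← mul_assoc, h10, neg_mul, mul_assoc (diagGen l 0),
        diagGen_mul_self, neg_mul, mul_smul_one, smul_mul_assoc, h20, smul_neg]
    have h2 : diagGen l 2 * diagPseudoscalar l = l 2 • (diagGen l 0 * diagGen l 1) := by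
      rw [diagPseudoscalar, ← mul_assoc, ← mul_assoc, h20, neg_mul, mul_assoc (diagGen l 0), h21,
        mul_neg, neg_neg, mul_assoc, mul_assoc, diagGen_mul_self, mul_smul_one, mul_smul_comm]
    simp only [ι_eq_sum_diagGen, mul_add, add_mul, mul_smul_comm, smul_mul_assoc, h0, h1, h2,
      diagPseudoscalar_mul_diagGen_zero, diagPseudoscalar_mul_diagGen_one,
      diagPseudoscalar_mul_diagGen_two]
  · have hc (i) : cliffordConj (diagGen l i) = -diagGen l i := cliffordConj_ι _
    rw [diagPseudoscalar, cliffordConj_mul, cliffordConj_mul, hc, hc, hc, neg_mul_neg, h10,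
      mul_neg, neg_mul, neg_neg, ← mul_assoc, h20, neg_mul, mul_assoc, h21, mul_neg, neg_neg,
      mul_assoc]

/-- Every element of the Clifford algebra is a combination of `1` and the three generators, with
coefficients that are central and fixed by Clifford conjugation. -/
theorem exists_eq_add_centralSelfConj_mul_diagGen (hl : ∀ i, l i * l i = 1)
    (x : CliffordAlgebra (QuadraticMap.weightedSumSquares ℝ l)) :
    ∃ z ∈ centralSelfConj (QuadraticMap.weightedSumSquares ℝ l),
      ∃ c : Fin 3 → centralSelfConj (QuadraticMap.weightedSumSquares ℝ l),
        x = z + c 0 * diagGen l 0 + c 1 * diagGen l 1 + c 2 * diagGen l 2 := by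
  induction x using CliffordAlgebra.left_induction with
  | algebraMap r => exact ⟨_, Subalgebra.algebraMap_mem _ r, 0, by simp⟩
  | add x y hx hy =>
    obtain ⟨z, hz, c, rfl⟩ := hx
    obtain ⟨w, hw, d, rfl⟩ := hy
    refine ⟨z + w, add_mem hz hw, c + d, ?_⟩
    simp only [Pi.add_apply, Subalgebra.coe_add, add_mul]
    abel
  | ι_mul x v hx =>
    obtain ⟨z, hz, c, rfl⟩ := hx
    let p : centralSelfConj (QuadraticMap.weightedSumSquares ℝ l) :=
      ⟨_, diagPseudoscalar_mem_centralSelfConj l⟩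
    let z' : centralSelfConj (QuadraticMap.weightedSumSquares ℝ l) := ⟨z, hz⟩
    refine ⟨_, ((v 0 * l 0) • c 0 + (v 1 * l 1) • c 1 + (v 2 * l 2) • c 2).2,
      ![v 0 • z' + l 0 • ((v 1 • c 2 - v 2 • c 1) * p),
        v 1 • z' + l 1 • ((v 2 • c 0 - v 0 • c 2) * p),
        v 2 • z' + l 2 • ((v 0 • c 1 - v 1 • c 0) * p)], ?_⟩
    have hzc (i) : diagGen l i * z = z * diagGen l i := (hz.1 _).symm
    have hcc (i j) : diagGen l i * (c j * diagGen l j) = c j * (diagGen l i * diagGen l j) := by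
      rw [← mul_assoc, ← (c j).2.1, mul_assoc]
    have h10 := diagGen_mul_comm l (show (1 : Fin 3) ≠ 0 by decide)
    have h02 := diagGen_mul_comm l (show (0 : Fin 3) ≠ 2 by decide)
    have h21 := diagGen_mul_comm l (show (2 : Fin 3) ≠ 1 by decide)
    simp only [ι_eq_sum_diagGen, Matrix.cons_val, Subalgebra.coe_add, Subalgebra.coe_mul,
      Subalgebra.coe_smul, Subalgebra.coe_sub, mul_add, add_mul, sub_mul, smul_mul_assoc, hzc,
      hcc, diagGen_mul_self, mul_assoc, z', p, diagPseudoscalar_mul_diagGen_zero,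
      diagPseudoscalar_mul_diagGen_one, diagPseudoscalar_mul_diagGen_two, h10, h02, h21,
      mul_smul_comm, mul_neg, smul_sub, smul_neg, mul_one, smul_smul]
    have e (i) (a : ℝ) : l i * (a * l i) = a := by linear_combination a * hl i
    simp only [e]
    module

theorem mul_cliffordConj_mem_centralSelfConj (hl : ∀ i, l i * l i = 1)
    (x : CliffordAlgebra (QuadraticMap.weightedSumSquares ℝ l)) :
    x * cliffordConj x ∈ centralSelfConj (QuadraticMap.weightedSumSquares ℝ l) := by
  have hinv (y : CliffordAlgebra (QuadraticMap.weightedSumSquares ℝ l)) :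
      cliffordConj (cliffordConj y) = y := by
    simp [cliffordConj, reverse_involute]
  have hself : cliffordConj (x * cliffordConj x) = x * cliffordConj x := by
    rw [cliffordConj_mul, hinv]
  obtain ⟨z, hz, c, hc⟩ := exists_eq_add_centralSelfConj_mul_diagGen hl (x * cliffordConj x)
  have hconj (i) : cliffordConj ((c i).1 * diagGen l i) = -((c i).1 * diagGen l i) := by
    rw [cliffordConj_mul, (c i).2.2, diagGen, cliffordConj_ι, neg_mul, (c i).2.1]
  rw [hc, cliffordConj_add, cliffordConj_add, cliffordConj_add, hz.2, hconj, hconj, hconj] at hself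
  have hzero : x * cliffordConj x = z := by
    rw [hc]
    linear_combination (norm := module) (-(1 / 2 : ℝ)) • hself
  rwa [hzero]

end WeightedSumSquares

theorem cliffordConj_norm_multiplicative
    (l : Fin 3 → ℝ) (hl : ∀ i, l i = 1 ∨ l i = -1)
    (Q : QuadraticForm ℝ (Fin 3 → ℝ)) (hQ : Q = QuadraticMap.weightedSumSquares ℝ l)
    (x y : CliffordAlgebra Q) :
    (x * y) * cliffordConj (x * y) = (x * cliffordConj x) * (y * cliffordConj y) := by
  subst hQ
  have hl' (i) : l i * l i = 1 := by rcases hl i with h | h <;> simp [h]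
  rw [cliffordConj_mul, mul_assoc, ← mul_assoc y,
    (mul_cliffordConj_mem_centralSelfConj hl' y).1, mul_assoc]
end
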